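/- Let b, c, K, s₁, s₂, s₃ be complex constants with c ≠ 0, and let u be a meromorphic solution of (E) that is an elliptic function with fundamental periods ω₁, ω₂ (linearly independent over ℝ). Then u has at most two distinct poles in any fundamental parallelogram {z₀ + t₁ω₁ + t₂ω₂ : 0 ≤ t₁ < 1, 0 ≤ t₂ < 1}. -/

import Mathlib

open Complex Filter Topology

noncomputable section

/-- `u` has a pole at `z₀`: `‖u z‖ → ∞` as `z → z₀`, `z ≠ z₀`. -/
def IsPoleAt (u : ℂ → ℂ) (z₀ : ℂ) : Prop :=
  Tendsto (fun z => ‖u z‖) (𝓝[≠] z₀) atTop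

/-- `u` is meromorphic on all of `ℂ`: at every point it is either analytic or has a pole. -/
def MeromorphicOnPlane (u : ℂ → ℂ) : Prop :=
  ∀ z : ℂ, AnalyticAt ℂ u z ∨ IsPoleAt u z

/-- Equation (E) at the point `z`. -/
def SatisfiesE (b c K s₁ s₂ s₃ : ℂ) (u : ℂ → ℂ) (z : ℂ) : Prop :=
  deriv u z * iteratedDeriv 3 u z - (1/2) * (iteratedDeriv 2 u z)^2
    + 30 * b * (deriv u z)^2
    - (30 / c^2) * ((u z)^4 - 4*s₁*(u z)^3 + 6*s₂*(u z)^2 - 4*s₃*(u z)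
        + 3*s₁^4 - 6*s₁^2*s₂ + 4*s₁*s₃) = K

/-- A meromorphic solution of (E). -/
def IsMeromorphicSolution (b c K s₁ s₂ s₃ : ℂ) (u : ℂ → ℂ) : Prop :=
  MeromorphicOnPlane u ∧ ∀ z : ℂ, AnalyticAt ℂ u z → SatisfiesE b c K s₁ s₂ s₃ u z

/-- `p` is a period of the meromorphic function `u`. -/
def IsPeriodOf (u : ℂ → ℂ) (p : ℂ) : Prop :=
  ∀ z : ℂ, ¬ IsPoleAt u z → u (z + p) = u z

/-! ### Leading terms of Laurent expansions -/

/-- Near `x`, the function `f` is `(z - x) ^ n` times an analytic function with value `a` at `x`;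
the value `a = 0` is allowed. -/
def HasLeadingTerm (f : ℂ → ℂ) (x : ℂ) (n : ℤ) (a : ℂ) : Prop :=
  ∃ g : ℂ → ℂ, AnalyticAt ℂ g x ∧ g x = a ∧ ∀ᶠ z in 𝓝[≠] x, f z = (z - x) ^ n * g z

namespace HasLeadingTerm

variable {f g : ℂ → ℂ} {x a b : ℂ} {m n : ℤ}

theorem const (a : ℂ) : HasLeadingTerm (fun _ => a) x 0 a :=
  ⟨fun _ => a, analyticAt_const, rfl, by simp⟩

theorem add (hf : HasLeadingTerm f x n a) (hg : HasLeadingTerm g x n b) :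
    HasLeadingTerm (fun z => f z + g z) x n (a + b) := by
  obtain ⟨φ, hφ, rfl, e⟩ := hf
  obtain ⟨ψ, hψ, rfl, e'⟩ := hg
  refine ⟨fun z => φ z + ψ z, hφ.add hψ, rfl, ?_⟩
  filter_upwards [e, e'] with z e e'
  rw [e, e', mul_add]

theorem sub (hf : HasLeadingTerm f x n a) (hg : HasLeadingTerm g x n b) :
    HasLeadingTerm (fun z => f z - g z) x n (a - b) := by
  obtain ⟨φ, hφ, rfl, e⟩ := hf
  obtain ⟨ψ, hψ, rfl, e'⟩ := hg
  refine ⟨fun z => φ z - ψ z, hφ.sub hψ, rfl, ?_⟩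
  filter_upwards [e, e'] with z e e'
  rw [e, e', mul_sub]

theorem mul (hf : HasLeadingTerm f x m a) (hg : HasLeadingTerm g x n b) :
    HasLeadingTerm (fun z => f z * g z) x (m + n) (a * b) := by
  obtain ⟨φ, hφ, rfl, e⟩ := hf
  obtain ⟨ψ, hψ, rfl, e'⟩ := hg
  refine ⟨fun z => φ z * ψ z, hφ.mul hψ, rfl, ?_⟩
  filter_upwards [e, e', self_mem_nhdsWithin] with z e e' hz
  rw [e, e', zpow_add₀ (sub_ne_zero.2 hz)]
  ring

theorem const_mul (c : ℂ) (hf : HasLeadingTerm f x n a) :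
    HasLeadingTerm (fun z => c * f z) x n (c * a) := by
  simpa using (const c).mul hf

theorem pow (hf : HasLeadingTerm f x n a) (k : ℕ) :
    HasLeadingTerm (fun z => f z ^ k) x (k * n) (a ^ k) := by
  induction k with
  | zero => simpa using const (1 : ℂ)
  | succ k ih => simpa only [pow_succ, Nat.cast_succ, add_mul, one_mul] using ih.mul hf

theorem of_lt (hf : HasLeadingTerm f x n a) (h : m < n) : HasLeadingTerm f x m 0 := by
  obtain ⟨φ, hφ, -, e⟩ := hf
  obtain ⟨k, rfl⟩ : ∃ k : ℕ, n = m + ((k + 1 : ℕ) : ℤ) := ⟨(n - m - 1).toNat, by omega⟩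
  refine ⟨fun z => (z - x) ^ (k + 1) * φ z, by fun_prop, by simp, ?_⟩
  filter_upwards [e, self_mem_nhdsWithin] with z e hz
  rw [e, zpow_add₀ (sub_ne_zero.2 hz), zpow_natCast, mul_assoc]

theorem unique (hf : HasLeadingTerm f x n a) (hg : HasLeadingTerm f x n b) : a = b := by
  obtain ⟨φ, hφ, rfl, e⟩ := hf
  obtain ⟨ψ, hψ, rfl, e'⟩ := hg
  refine tendsto_nhds_unique (hφ.continuousAt.tendsto.mono_left nhdsWithin_le_nhds)
    ((hψ.continuousAt.tendsto.mono_left (nhdsWithin_le_nhds (s := {x}ᶜ))).congr' ?_)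
  filter_upwards [e, e', self_mem_nhdsWithin] with z e e' hz
  exact mul_left_cancel₀ (zpow_ne_zero n (sub_ne_zero.2 hz)) (e'.symm.trans e)

theorem eq_zero_of_eventually_eq_zero (hf : HasLeadingTerm f x n a)
    (h : ∀ᶠ z in 𝓝[≠] x, f z = 0) : a = 0 :=
  hf.unique ⟨fun _ => 0, analyticAt_const, rfl, by simpa using h⟩

protected theorem deriv (hf : HasLeadingTerm f x n a) :
    HasLeadingTerm (deriv f) x (n - 1) (n * a) := by
  obtain ⟨φ, hφ, rfl, e⟩ := hf
  refine ⟨fun z => n * φ z + (z - x) * deriv φ z, ?_, by simp, ?_⟩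
  · have := hφ.deriv
    fun_prop
  · filter_upwards [eventually_eventually_nhdsWithin.2 e, self_mem_nhdsWithin,
      hφ.eventually_analyticAt.filter_mono nhdsWithin_le_nhds] with z e hz hφz
    have hz' : z - x ≠ 0 := sub_ne_zero.2 hz
    have e' : f =ᶠ[𝓝 z] fun y => (y - x) ^ n * φ y := by
      rwa [isOpen_compl_singleton.nhdsWithin_eq hz] at e
    have hpow : HasDerivAt (fun y : ℂ => (y - x) ^ n) (n * (z - x) ^ (n - 1)) z := by
      simpa [Function.comp_def] using
        (hasDerivAt_zpow n (z - x) (Or.inl hz')).comp z ((hasDerivAt_id z).sub_const x)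
    rw [e'.deriv_eq, (hpow.fun_mul hφz.differentiableAt.hasDerivAt).deriv, mul_add]
    have hsplit : (z - x) ^ n = (z - x) ^ (n - 1) * (z - x) := by
      rw [← zpow_add_one₀ hz', sub_add_cancel]
    rw [hsplit]
    ring

theorem comp_add (p : ℂ) (hf : HasLeadingTerm f (x + p) n a) :
    HasLeadingTerm (fun z => f (z + p)) x n a := by
  obtain ⟨φ, hφ, rfl, e⟩ := hf
  refine ⟨fun z => φ (z + p),
    AnalyticAt.fun_comp (g := φ) (f := fun z => z + p) hφ (by fun_prop), rfl, ?_⟩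
  have ht : Tendsto (fun z => z + p) (𝓝[≠] x) (𝓝[≠] (x + p)) :=
    ((continuous_add_const p).continuousAt.tendsto).inf
      (tendsto_principal_principal.2 fun z hz => by simpa using hz)
  filter_upwards [ht.eventually e] with z e
  simpa using e

end HasLeadingTerm

theorem MeromorphicAt.exists_hasLeadingTerm {f : ℂ → ℂ} {x : ℂ} (hf : MeromorphicAt f x) :
    (∀ᶠ z in 𝓝[≠] x, f z = 0) ∨
      ∃ n : ℤ, meromorphicOrderAt f x = n ∧ ∃ a : ℂ, a ≠ 0 ∧ HasLeadingTerm f x n a := by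
  by_cases h : meromorphicOrderAt f x = ⊤
  · exact Or.inl (meromorphicOrderAt_eq_top_iff.1 h)
  · obtain ⟨n, hn⟩ := WithTop.ne_top_iff_exists.1 h
    obtain ⟨g, hg, h0, e⟩ := (meromorphicOrderAt_eq_int_iff hf).1 hn.symm
    exact Or.inr ⟨n, hn.symm, g x, h0, g, hg, rfl, by simpa using e⟩

theorem MeromorphicAt.eventually_deriv_eq_sub {d f g : ℂ → ℂ} {x : ℂ} (hf : MeromorphicAt f x)
    (hg : MeromorphicAt g x) (h : ∀ᶠ z in 𝓝[≠] x, d z = f z - g z) :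
    ∀ᶠ z in 𝓝[≠] x, deriv d z = deriv f z - deriv g z := by
  filter_upwards [hf.eventually_analyticAt, hg.eventually_analyticAt,
    eventually_eventually_nhdsWithin.2 h, self_mem_nhdsWithin] with z hfz hgz e hz
  rw [isOpen_compl_singleton.nhdsWithin_eq hz] at e
  rw [EventuallyEq.deriv_eq e]
  exact deriv_fun_sub hfz.differentiableAt hgz.differentiableAt

/-! ### Poles of functions meromorphic on the plane -/

theorem not_isPoleAt_of_tendsto {f : ℂ → ℂ} {x y : ℂ} (h : Tendsto f (𝓝[≠] x) (𝓝 y)) :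
    ¬ IsPoleAt f x := fun hp => not_tendsto_nhds_of_tendsto_atTop hp _ h.norm

theorem AnalyticAt.not_isPoleAt {f : ℂ → ℂ} {x : ℂ} (h : AnalyticAt ℂ f x) : ¬ IsPoleAt f x :=
  not_isPoleAt_of_tendsto (h.continuousAt.tendsto.mono_left nhdsWithin_le_nhds)

theorem countable_setOf_isPoleAt (u : ℂ → ℂ) : {z | IsPoleAt u z}.Countable := by
  have hU : {z | IsPoleAt u z} ⊆ ⋃ n : ℕ, {z | IsPoleAt u z ∧ ‖u z‖ ≤ n} := fun z hz => by
    obtain ⟨n, hn⟩ := exists_nat_ge ‖u z‖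
    exact Set.mem_iUnion.2 ⟨n, hz, hn⟩
  refine (Set.countable_iUnion fun n => ?_).mono hU
  have : DiscreteTopology {z | IsPoleAt u z ∧ ‖u z‖ ≤ n} := by
    refine discreteTopology_subtype_iff.2 fun z hz => ?_
    rw [← disjoint_iff, disjoint_principal_right]
    filter_upwards [hz.1.eventually_gt_atTop (n : ℝ)] with w hw hw'
    exact hw.not_ge hw'.2
  exact Set.countable_coe_iff.1 (TopologicalSpace.separableSpace_iff_countable.1 inferInstance)

namespace MeromorphicOnPlane

variable {u : ℂ → ℂ}

theorem analyticAt (hu : MeromorphicOnPlane u) {z : ℂ} (hz : ¬ IsPoleAt u z) : AnalyticAt ℂ u z :=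
  (hu z).resolve_right hz

theorem meromorphicAt (hu : MeromorphicOnPlane u) (x : ℂ) : MeromorphicAt u x := by
  classical
  refine (hu x).elim AnalyticAt.meromorphicAt fun hx => ?_
  let w : ℂ → ℂ := fun z => if IsPoleAt u z then 0 else (u z)⁻¹
  have hw : ∀ z, ‖w z‖ ≤ ‖u z‖⁻¹ := fun z => by
    by_cases h : IsPoleAt u z <;> simp [w, h]
  have hw_pole : ∀ z, IsPoleAt u z → ContinuousAt w z := fun z hz => by
    have h0 : w z = 0 := if_pos hz
    rw [continuousAt_iff_punctured_nhds, h0]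
    exact squeeze_zero_norm hw hz.inv_tendsto_atTop
  have hw_diff : ∀ z, ¬ IsPoleAt u z → u z ≠ 0 → DifferentiableAt ℂ w z := fun z hz h0 => by
    have ha := hu.analyticAt hz
    refine (ha.differentiableAt.inv h0).congr_of_eventuallyEq ?_
    filter_upwards [ha.eventually_analyticAt] with y hy
    exact if_neg hy.not_isPoleAt
  obtain ⟨R, hR, hball⟩ := Metric.nhdsWithin_basis_ball.eventually_iff.1
    (hx.eventually_gt_atTop 0)
  have hd : ∀ z ∈ Metric.ball x R \ {z | IsPoleAt u z}, DifferentiableAt ℂ w z := fun z hz =>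
    hw_diff z hz.2 (norm_pos_iff.1 (hball ⟨hz.1, fun h => hz.2 (h ▸ hx)⟩))
  lift R to NNReal using hR.le
  have hsub : Metric.closedBall x ((R / 2 : NNReal) : ℝ) ⊆ Metric.ball x R :=
    Metric.closedBall_subset_ball (by push_cast; linarith)
  have hwx : AnalyticAt ℂ w x := by
    refine (Complex.hasFPowerSeriesOnBall_of_differentiable_off_countable (R := R / 2)
      (countable_setOf_isPoleAt u) (fun z hz => ?_)
      (fun z hz => hd z ⟨hsub (Metric.ball_subset_closedBall hz.1), hz.2⟩)
      (half_pos (by exact_mod_cast hR))).analyticAt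
    by_cases h : IsPoleAt u z
    · exact (hw_pole z h).continuousWithinAt
    · exact (hd z ⟨hsub hz, h⟩).continuousAt.continuousWithinAt
  have hne : ∀ᶠ z in 𝓝[≠] x, w z ≠ 0 := by
    refine hwx.eventually_eq_zero_or_eventually_ne_zero.resolve_left fun h0 => ?_
    obtain ⟨r, hr, hr0⟩ := Metric.eventually_nhds_iff_ball.1 h0
    have hpos : 0 < min r R := lt_min hr hR
    have hcount : (Metric.ball x (min r R)).Countable := by
      refine (countable_setOf_isPoleAt u).mono fun z hz => ?_
      by_contra h
      have h1 : w z = (u z)⁻¹ := if_neg h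
      have h2 := hr0 z (Metric.ball_subset_ball (min_le_left _ _) hz)
      have h3 := hball (show z ∈ Metric.ball x R ∩ {x}ᶜ from
        ⟨Metric.ball_subset_ball (min_le_right _ _) hz, fun e => h (e ▸ hx)⟩)
      exact norm_pos_iff.1 h3 (inv_eq_zero.1 (h1 ▸ h2))
    exact (hcount.dense_compl ℝ).inter_open_nonempty _ Metric.isOpen_ball
      ⟨x, Metric.mem_ball_self hpos⟩ |>.elim fun z hz => hz.2 hz.1
  refine hwx.meromorphicAt.inv.congr ?_
  filter_upwards [hne] with z hz
  have h : ¬ IsPoleAt u z := fun h => hz (if_pos h)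
  simp [w, h]

theorem comp_add (hu : MeromorphicOnPlane u) (p x : ℂ) :
    MeromorphicAt (fun z => u (z + p)) x :=
  MeromorphicAt.comp_analyticAt (f := u) (g := fun z => z + p) (hu.meromorphicAt (x + p))
    (by fun_prop)

theorem isPeriodOf_of_eventually_eq (hu : MeromorphicOnPlane u) {p x : ℂ}
    (h : ∀ᶠ z in 𝓝[≠] x, u (z + p) - u z = 0) : IsPeriodOf u p := by
  have hm : Meromorphic (fun z => u (z + p) - u z) := fun z =>
    (hu.comp_add p z).sub (hu.meromorphicAt z)
  have hall : ∀ z, ∀ᶠ y in 𝓝[≠] z, u (y + p) - u y = 0 := by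
    by_contra hz
    obtain ⟨z, hz⟩ := not_forall.1 hz
    exact (hm.exists_meromorphicOrderAt_ne_top_iff_forall.1
      ⟨z, fun e => hz (meromorphicOrderAt_eq_top_iff.1 e)⟩ x) (meromorphicOrderAt_eq_top_iff.2 h)
  intro z hz
  have hcu : Tendsto u (𝓝[≠] z) (𝓝 (u z)) :=
    (hu.analyticAt hz).continuousAt.tendsto.mono_left nhdsWithin_le_nhds
  have hcv : Tendsto (fun y => u (y + p)) (𝓝[≠] z) (𝓝 (u z)) := by
    refine hcu.congr' ?_
    filter_upwards [hall z] with y hy using (sub_eq_zero.1 hy).symm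
  have ht : Tendsto (fun y => y - p) (𝓝[≠] (z + p)) (𝓝[≠] z) := by
    have h1 : Tendsto (fun y => y - p) (𝓝 (z + p)) (𝓝 z) := by
      simpa using (show Continuous fun y : ℂ => y - p by fun_prop).tendsto (z + p)
    exact h1.inf (tendsto_principal_principal.2 fun y hy => by
      simpa [sub_eq_iff_eq_add] using hy)
  have hzp : ¬ IsPoleAt u (z + p) := by
    refine not_isPoleAt_of_tendsto (y := u z) ?_
    simpa [Function.comp_def] using hcv.comp ht
  have hzc : ContinuousAt (fun y => u (y + p)) z :=
    ContinuousAt.comp' (g := u) (f := fun y => y + p) (hu.analyticAt hzp).continuousAt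
      (by fun_prop)
  exact tendsto_nhds_unique (hzc.tendsto.mono_left nhdsWithin_le_nhds) hcv

end MeromorphicOnPlane

/-! ### Local analysis of (E) at a pole -/

theorem iteratedDeriv_three_eq (f : ℂ → ℂ) : iteratedDeriv 3 f = deriv (deriv (deriv f)) := by
  simp [iteratedDeriv_succ, iteratedDeriv_zero]

theorem iteratedDeriv_two_eq (f : ℂ → ℂ) : iteratedDeriv 2 f = deriv (deriv f) := by
  simp [iteratedDeriv_succ, iteratedDeriv_zero]

section Equation

variable {b c K s₁ s₂ s₃ : ℂ} {u v : ℂ → ℂ} {x : ℂ}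

theorem HasLeadingTerm.quartic {n : ℤ} {a : ℂ} (hn : n < 0) (hu : HasLeadingTerm u x n a) :
    HasLeadingTerm (fun z => (u z)^4 - 4*s₁*(u z)^3 + 6*s₂*(u z)^2 - 4*s₃*(u z)
      + (3*s₁^4 - 6*s₁^2*s₂ + 4*s₁*s₃)) x (4 * n) (a ^ 4) := by
  have h4 := hu.pow 4
  have h3 := ((hu.pow 3).const_mul (4*s₁)).of_lt (m := 4 * n) (by push_cast; omega)
  have h2 := ((hu.pow 2).const_mul (6*s₂)).of_lt (m := 4 * n) (by push_cast; omega)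
  have h1 := (hu.const_mul (4*s₃)).of_lt (m := 4 * n) (by omega)
  have h0 := (HasLeadingTerm.const (x := x) (3*s₁^4 - 6*s₁^2*s₂ + 4*s₁*s₃)).of_lt
    (m := 4 * n) (by omega)
  simpa using (((h4.sub h3).add h2).sub h1).add h0

theorem HasLeadingTerm.differentialPart (b : ℂ) {n : ℤ} {a : ℂ} (hu : HasLeadingTerm u x n a) :
    HasLeadingTerm (fun z => deriv u z * iteratedDeriv 3 u z - (1/2) * (iteratedDeriv 2 u z)^2
      + 30 * b * (deriv u z)^2) x (2 * n - 4) (a ^ 2 * n ^ 2 * (n - 1) * (n - 3) / 2) := by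
  rw [iteratedDeriv_three_eq, iteratedDeriv_two_eq]
  have hA := hu.deriv.mul hu.deriv.deriv.deriv
  have hB := (hu.deriv.deriv.pow 2).const_mul (1/2)
  have hC := ((hu.deriv.pow 2).const_mul (30 * b)).of_lt (m := 2 * n - 4) (by push_cast; omega)
  rw [show n - 1 + (n - 1 - 1 - 1) = 2 * n - 4 by ring] at hA
  rw [show ((2 : ℕ) : ℤ) * (n - 1 - 1) = 2 * n - 4 by push_cast; ring] at hB
  convert (hA.sub hB).add hC using 1
  push_cast
  ring

/-- A pole of a solution of (E) is double, with leading coefficient `c` or `-c`. -/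
theorem HasLeadingTerm.pole_of_satisfiesE (hc : c ≠ 0) {n : ℤ} {a : ℂ} (hn : n < 0) (ha : a ≠ 0)
    (hu : HasLeadingTerm u x n a) (hE : ∀ᶠ z in 𝓝[≠] x, SatisfiesE b c K s₁ s₂ s₃ u z) :
    n = -2 ∧ (a = c ∨ a = -c) := by
  have hD := hu.differentialPart b
  have hQ := (hu.quartic (s₁ := s₁) (s₂ := s₂) (s₃ := s₃) hn).const_mul (30 / c^2)
  have hK := HasLeadingTerm.const (x := x) K
  have hzero : ∀ {N : ℤ} {α β γ : ℂ},
      HasLeadingTerm (fun z => deriv u z * iteratedDeriv 3 u z - (1/2) * (iteratedDeriv 2 u z)^2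
        + 30 * b * (deriv u z)^2) x N α →
      HasLeadingTerm (fun z => 30 / c^2 * ((u z)^4 - 4*s₁*(u z)^3 + 6*s₂*(u z)^2 - 4*s₃*(u z)
        + (3*s₁^4 - 6*s₁^2*s₂ + 4*s₁*s₃))) x N β →
      HasLeadingTerm (fun _ => K) x N γ → α - β - γ = 0 := fun h₁ h₂ h₃ => by
    refine ((h₁.sub h₂).sub h₃).eq_zero_of_eventually_eq_zero ?_
    filter_upwards [hE] with z hz
    rw [SatisfiesE] at hz
    linear_combination hz
  have hn0 : (n : ℂ) ≠ 0 := by exact_mod_cast hn.ne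
  have hn1 : (n : ℂ) - 1 ≠ 0 := by exact_mod_cast (by omega : n - 1 ≠ 0)
  have hn3 : (n : ℂ) - 3 ≠ 0 := by exact_mod_cast (by omega : n - 3 ≠ 0)
  rcases lt_trichotomy n (-2) with h | rfl | h
  · have := hzero (hD.of_lt (m := 4 * n) (by omega)) hQ (hK.of_lt (by omega))
    simp [ha, hc] at this
  · refine ⟨rfl, ?_⟩
    have := hzero hD hQ (hK.of_lt (by omega))
    push_cast at this
    field_simp at this
    have h1 : 30 * a ^ 2 * ((a - c) * (a + c)) = 0 := by linear_combination -this
    have h2 := (mul_eq_zero.1 h1).resolve_left (by simp [ha])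
    rcases mul_eq_zero.1 h2 with h | h
    · exact Or.inl (sub_eq_zero.1 h)
    · exact Or.inr (eq_neg_of_add_eq_zero_left h)
  · have := hzero hD (hQ.of_lt (m := 2 * n - 4) (by omega)) (hK.of_lt (by omega))
    simp [ha, hn0, hn1, hn3] at this

/-- The Laurent expansion of a solution of (E) at a pole is determined by its leading coefficient,
since the Fuchs indices `r` solve `(r + 1) * (r ^ 2 - 7 * r + 30) = 0`. -/
theorem HasLeadingTerm.eventually_eq_of_satisfiesE {a : ℂ} (ha : a ≠ 0) (hac : a ^ 2 = c ^ 2)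
    (hmu : MeromorphicAt u x) (hmv : MeromorphicAt v x)
    (hu : HasLeadingTerm u x (-2) a) (hv : HasLeadingTerm v x (-2) a)
    (hEu : ∀ᶠ z in 𝓝[≠] x, SatisfiesE b c K s₁ s₂ s₃ u z)
    (hEv : ∀ᶠ z in 𝓝[≠] x, SatisfiesE b c K s₁ s₂ s₃ v z) :
    ∀ᶠ z in 𝓝[≠] x, v z - u z = 0 := by
  refine (hmv.sub hmu).exists_hasLeadingTerm.resolve_right ?_
  rintro ⟨n, -, h, hh, hd⟩
  change HasLeadingTerm (fun z => v z - u z) x n h at hd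
  have hn : -2 < n := by
    by_contra! hle
    rcases hle.lt_or_eq with hlt | rfl
    · exact hh (hd.unique ((hv.sub hu).of_lt hlt))
    · exact hh (by simpa using hd.unique (hv.sub hu))
  set d : ℂ → ℂ := fun z => v z - u z with hd_def
  have hd1 := hmv.eventually_deriv_eq_sub hmu (d := d) (.of_forall fun _ => rfl)
  have hderiv2 := hmv.deriv.eventually_deriv_eq_sub hmu.deriv hd1
  have hderiv3 := hmv.deriv.deriv.eventually_deriv_eq_sub hmu.deriv.deriv hderiv2
  have hA := hu.deriv.mul hd.deriv.deriv.deriv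
  have hB := hv.deriv.deriv.deriv.mul hd.deriv
  have hC := ((hu.deriv.deriv.add hv.deriv.deriv).mul hd.deriv.deriv).const_mul (1/2)
  have hb := (((hu.deriv.add hv.deriv).mul hd.deriv).const_mul (30 * b)).of_lt
    (m := n - 6) (by omega)
  have hcubic := ((((hu.pow 3).add (((hu.pow 2).mul hv))).add (hu.mul (hv.pow 2))).add (hv.pow 3))
  have hquad := ((((hu.pow 2).add (hu.mul hv)).add (hv.pow 2)).const_mul (4*s₁)).of_lt
    (m := -6) (by norm_num)
  have hlin := ((hu.add hv).const_mul (6*s₂)).of_lt (m := -6) (by norm_num)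
  have hcst := (HasLeadingTerm.const (x := x) (4*s₃)).of_lt (m := -6) (by norm_num)
  have hQ := (((((hcubic.sub hquad).add hlin).sub hcst).mul hd).const_mul (30 / c^2))
  rw [show (-2 - 1 + (n - 1 - 1 - 1) : ℤ) = n - 6 by ring] at hA
  rw [show (-2 - 1 - 1 - 1 + (n - 1) : ℤ) = n - 6 by ring] at hB
  rw [show (-2 - 1 - 1 + (n - 1 - 1) : ℤ) = n - 6 by ring] at hC
  rw [show ((3 : ℕ) : ℤ) * -2 + n = n - 6 by push_cast; ring] at hQ
  have key := ((((hA.add hB).sub hC).add hb).sub hQ).eq_zero_of_eventually_eq_zero (by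
    filter_upwards [hEu, hEv, hd1, hderiv2, hderiv3] with z e e' h1 h2 h3
    rw [SatisfiesE, iteratedDeriv_three_eq, iteratedDeriv_two_eq] at e e'
    rw [h1, h2, h3, hd_def]
    linear_combination e' - e)
  have hc2 : c ^ 2 ≠ 0 := hac ▸ pow_ne_zero 2 ha
  have hc0 : c ≠ 0 := fun h => hc2 (by simp [h])
  rw [← hac] at key
  push_cast at key
  field_simp at key
  have hroot : ((n : ℂ) + 3) * ((n : ℂ) ^ 2 - 3 * n + 20) = 0 := by
    have : 2 * a ^ 3 * h * (((n : ℂ) + 3) * ((n : ℂ) ^ 2 - 3 * n + 20)) = 0 := by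
      linear_combination -key
    exact (mul_eq_zero.1 this).resolve_left (by simp [ha, hh])
  have hroot' : (n + 3) * (n ^ 2 - 3 * n + 20) = 0 := by exact_mod_cast hroot
  rcases mul_eq_zero.1 hroot' with h | h
  · omega
  · nlinarith [sq_nonneg (2 * n - 3)]

end Equation

theorem IsMeromorphicSolution.eventually_satisfiesE {b c K s₁ s₂ s₃ : ℂ} {u : ℂ → ℂ}
    (hu : IsMeromorphicSolution b c K s₁ s₂ s₃ u) (x : ℂ) :
    ∀ᶠ z in 𝓝[≠] x, SatisfiesE b c K s₁ s₂ s₃ u z :=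
  (hu.1.meromorphicAt x).eventually_analyticAt.mono hu.2

theorem IsMeromorphicSolution.exists_hasLeadingTerm {b c K s₁ s₂ s₃ : ℂ} (hc : c ≠ 0) {u : ℂ → ℂ}
    (hu : IsMeromorphicSolution b c K s₁ s₂ s₃ u) {x : ℂ} (hx : IsPoleAt u x) :
    ∃ a, (a = c ∨ a = -c) ∧ HasLeadingTerm u x (-2) a := by
  have hneg : meromorphicOrderAt u x < 0 :=
    (tendsto_cobounded_iff_meromorphicOrderAt_neg (hu.1.meromorphicAt x)).1
      (tendsto_norm_atTop_iff_cobounded.1 hx)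
  rcases (hu.1.meromorphicAt x).exists_hasLeadingTerm with h | ⟨n, hn, a, ha, h⟩
  · simp [meromorphicOrderAt_eq_top_iff.2 h] at hneg
  · obtain ⟨rfl, hac⟩ := h.pole_of_satisfiesE hc (by rw [hn] at hneg; exact_mod_cast hneg) ha
      (hu.eventually_satisfiesE x)
    exact ⟨a, hac, h⟩

/-- Poles of a solution of (E) with the same leading coefficient differ by a period. -/
theorem IsMeromorphicSolution.isPeriodOf_sub {b c K s₁ s₂ s₃ : ℂ} {u : ℂ → ℂ}
    (hu : IsMeromorphicSolution b c K s₁ s₂ s₃ u) {x y a : ℂ} (ha : a ≠ 0) (hac : a ^ 2 = c ^ 2)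
    (hx : HasLeadingTerm u x (-2) a) (hy : HasLeadingTerm u y (-2) a) :
    IsPeriodOf u (y - x) := by
  refine hu.1.isPeriodOf_of_eventually_eq (x := x) (hx.eventually_eq_of_satisfiesE ha hac
    (hu.1.meromorphicAt x) (hu.1.comp_add _ x) (HasLeadingTerm.comp_add _ (by simpa using hy))
    (hu.eventually_satisfiesE x) (b := b) (c := c) (K := K) (s₁ := s₁) (s₂ := s₂) (s₃ := s₃) ?_)
  have ht : Tendsto (fun z => z + (y - x)) (𝓝[≠] x) (𝓝[≠] y) := by
    have h1 : Tendsto (fun z => z + (y - x)) (𝓝 x) (𝓝 y) := by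
      simpa using (continuous_add_const (y - x)).tendsto x
    refine h1.inf (tendsto_principal_principal.2 fun z hz e => hz ?_)
    rw [Set.mem_singleton_iff] at e ⊢
    linear_combination e
  filter_upwards [ht.eventually (hu.eventually_satisfiesE y)] with z hz
  simpa only [SatisfiesE, deriv_comp_add_const, iteratedDeriv_comp_add_const] using hz

/-- An elliptic meromorphic solution of (E) has at most two distinct poles
in any fundamental parallelogram. -/
theorem at_most_two_poles_in_fundamental_parallelogram
    (b c K s₁ s₂ s₃ : ℂ) (hc : c ≠ 0)
    (u : ℂ → ℂ) (hu : IsMeromorphicSolution b c K s₁ s₂ s₃ u)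
    (ω₁ ω₂ : ℂ) (hindep : LinearIndependent ℝ ![ω₁, ω₂])
    (hper₁ : IsPeriodOf u ω₁) (hper₂ : IsPeriodOf u ω₂)
    (hfund : ∀ p : ℂ, IsPeriodOf u p → ∃ m n : ℤ, p = m * ω₁ + n * ω₂)
    (z₀ : ℂ) :
    Set.encard {z : ℂ | IsPoleAt u z ∧
      ∃ t₁ t₂ : ℝ, 0 ≤ t₁ ∧ t₁ < 1 ∧ 0 ≤ t₂ ∧ t₂ < 1 ∧
        z = z₀ + t₁ * ω₁ + t₂ * ω₂} ≤ 2 := by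
  have hterm : ∀ z, ∃ a, IsPoleAt u z → (a = c ∨ a = -c) ∧ HasLeadingTerm u z (-2) a := fun z => by
    by_cases hz : IsPoleAt u z
    · obtain ⟨a, ha⟩ := hu.exists_hasLeadingTerm hc hz
      exact ⟨a, fun _ => ha⟩
    · exact ⟨0, fun h => absurd h hz⟩
  choose a ha using hterm
  refine (Set.encard_le_encard_of_injOn (f := a) (t := {c, -c}) (fun z hz => (ha z hz.1).1)
    ?_).trans ((Set.encard_insert_le {-c} c).trans (by rw [Set.encard_singleton]; norm_num))
  rintro z ⟨hz, t₁, t₂, h₁, h₁', h₂, h₂', rfl⟩ w ⟨hw, r₁, r₂, k₁, k₁', k₂, k₂', rfl⟩ hzw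
  obtain ⟨hac, hlz⟩ := ha _ hz
  have hlw := (ha _ hw).2
  rw [← hzw] at hlw
  obtain ⟨m, n, hmn⟩ := hfund _ (hu.isPeriodOf_sub (by rcases hac with h | h <;> simp [h, hc])
    (by rcases hac with h | h <;> simp [h]) hlz hlw)
  obtain ⟨em, en⟩ := LinearIndependent.pair_iff.1 hindep (r₁ - t₁ - m) (r₂ - t₂ - n) (by
    simp only [Complex.real_smul]
    push_cast
    linear_combination hmn)
  have hm : m = 0 := by
    have l : (-1 : ℝ) < m := by linarith
    have r : (m : ℝ) < 1 := by linarith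
    have l' : -1 < m := by exact_mod_cast l
    have r' : m < 1 := by exact_mod_cast r
    omega
  have hn : n = 0 := by
    have l : (-1 : ℝ) < n := by linarith
    have r : (n : ℝ) < 1 := by linarith
    have l' : -1 < n := by exact_mod_cast l
    have r' : n < 1 := by exact_mod_cast r
    omega
  rw [hm, hn] at hmn
  push_cast at hmn
  linear_combination -hmn

end
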